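/- In an arbitrage-free discrete market model with proportional transaction costs, for an American option with adapted ℝ²-valued payoff process (ξ,ζ), the buyer's price satisfies π^b(ξ,ζ) = max over pure stopping times τ of the infimum over pairs (P,S) ∈ P(τ) of E_P(ξ_τ + S_τ ζ_τ), where P(τ) consists of the pairs in barP(τ) whose probability measure is equivalent to Q; the maximum over τ is attained. -/

import Mathlib

open MeasureTheory
open scoped Pointwise

noncomputable section

namespace RZ

variable {Ω : Type*} [Fintype Ω]

/-- `ω` and `ω'` lie in the same atom of the σ-field `m`. -/
def sameAtom (m : MeasurableSpace Ω) (ω ω' : Ω) : Prop :=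
  ∀ A : Set Ω, MeasurableSet[m] A → (ω ∈ A ↔ ω' ∈ A)

/-- Elementary conditional expectation w.r.t. a σ-field on a finite space:
at `ω` it is the `P`-average of `f` over the atom of `ω`. -/
def condExp (m : MeasurableSpace Ω) (P : Ω → ℝ) (f : Ω → ℝ) (ω : Ω) : ℝ :=
  (∑ ω' : Ω, Set.indicator {ω'' | sameAtom m ω ω''} (fun ω'' => P ω'' * f ω'') ω') /
  (∑ ω' : Ω, Set.indicator {ω'' | sameAtom m ω ω''} P ω')

/-- Expectation under `P`. -/
def expect (P : Ω → ℝ) (f : Ω → ℝ) : ℝ := ∑ ω : Ω, P ω * f ω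

/-- Discrete market model with proportional transaction costs. -/
structure Market (Ω : Type*) [Fintype Ω] where
  T : ℕ
  T_pos : 0 < T
  F : ℕ → MeasurableSpace Ω
  F_mono : ∀ ⦃s t : ℕ⦄, s ≤ t → F s ≤ F t
  F_zero : F 0 = ⊥
  F_top : F T = ⊤
  Q : Ω → ℝ
  Q_pos : ∀ ω, 0 < Q ω
  Q_sum : ∑ ω, Q ω = 1
  Sb : ℕ → Ω → ℝ
  Sa : ℕ → Ω → ℝ
  Sb_pos : ∀ t ω, t ≤ T → 0 < Sb t ω
  Sb_le_Sa : ∀ t ω, t ≤ T → Sb t ω ≤ Sa t ω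
  Sb_adapted : ∀ t, t ≤ T → Measurable[F t] (Sb t)
  Sa_adapted : ∀ t, t ≤ T → Measurable[F t] (Sa t)

variable (M : Market Ω)

/-- Liquidation value θ_t(γ, δ) in scenario ω, for a cash position γ and stock position δ. -/
def liq (t : ℕ) (ω : Ω) (γ δ : ℝ) : ℝ :=
  γ + M.Sb t ω * max δ 0 - M.Sa t ω * max (-δ) 0

/-- An adapted (real-valued) process. -/
def IsAdapted (X : ℕ → Ω → ℝ) : Prop := ∀ t, t ≤ M.T → Measurable[M.F t] (X t)

/-- An adapted ℝ²-valued payoff process. -/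
def AdaptedPair (ξ ζ : ℕ → Ω → ℝ) : Prop := IsAdapted M ξ ∧ IsAdapted M ζ

/-- Self-financing strategy. -/
def SelfFinancing (α β : ℕ → Ω → ℝ) : Prop :=
  Measurable[M.F 0] (α 0) ∧ Measurable[M.F 0] (β 0) ∧
  (∀ t, t < M.T → Measurable[M.F t] (α (t + 1)) ∧ Measurable[M.F t] (β (t + 1))) ∧
  (∀ t, t < M.T → ∀ ω, 0 ≤ liq M t ω (α t ω - α (t + 1) ω) (β t ω - β (t + 1) ω))

/-- Pure stopping time with values in {0,...,T}. -/
def IsStop (τ : Ω → ℕ) : Prop :=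
  (∀ ω, τ ω ≤ M.T) ∧ ∀ t : ℕ, MeasurableSet[M.F t] {ω | τ ω = t}

/-- Seller superhedging strategy. -/
def SellerHedge (ξ ζ α β : ℕ → Ω → ℝ) : Prop :=
  SelfFinancing M α β ∧
  ∀ τ, IsStop M τ → ∀ ω,
    0 ≤ liq M (τ ω) ω (α (τ ω) ω - ξ (τ ω) ω) (β (τ ω) ω - ζ (τ ω) ω)

/-- Buyer superhedging strategy. -/
def BuyerHedge (ξ ζ α β : ℕ → Ω → ℝ) : Prop :=
  SelfFinancing M α β ∧
  ∃ τ, IsStop M τ ∧ ∀ ω,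
    0 ≤ liq M (τ ω) ω (α (τ ω) ω + ξ (τ ω) ω) (β (τ ω) ω + ζ (τ ω) ω)

/-- Seller's (ask) price: infimum of the initial costs of seller superhedging strategies. -/
def askPrice (ξ ζ : ℕ → Ω → ℝ) : ℝ :=
  sInf {x | ∃ α β, SellerHedge M ξ ζ α β ∧ ∀ ω, x = -liq M 0 ω (-α 0 ω) (-β 0 ω)}

/-- Buyer's (bid) price: supremum of the amounts raised by buyer superhedging strategies. -/
def bidPrice (ξ ζ : ℕ → Ω → ℝ) : ℝ :=
  sSup {x | ∃ α β, BuyerHedge M ξ ζ α β ∧ ∀ ω, x = liq M 0 ω (-α 0 ω) (-β 0 ω)}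

/-- Mixed stopping time. -/
def IsMixedStop (χ : ℕ → Ω → ℝ) : Prop :=
  (∀ t, t ≤ M.T → Measurable[M.F t] (χ t)) ∧ (∀ t ω, 0 ≤ χ t ω) ∧
  ∀ ω, ∑ t ∈ Finset.range (M.T + 1), χ t ω = 1

/-- χ*_t = Σ_{s=t}^T χ_s  (so χ*_{T+1} = 0). -/
def chiStar (χ : ℕ → Ω → ℝ) (t : ℕ) (ω : Ω) : ℝ := ∑ s ∈ Finset.Icc t M.T, χ s ω

/-- Z^{χ*}_t = Σ_{s=t}^T χ_s Z_s  (so Z^{χ*}_{T+1} = 0). -/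
def starVal (χ Z : ℕ → Ω → ℝ) (t : ℕ) (ω : Ω) : ℝ :=
  ∑ s ∈ Finset.Icc t M.T, χ s ω * Z s ω

/-- Z_χ = Σ_{t=0}^T χ_t Z_t. -/
def mixVal (χ Z : ℕ → Ω → ℝ) (ω : Ω) : ℝ :=
  ∑ t ∈ Finset.range (M.T + 1), χ t ω * Z t ω

/-- Membership in the family barP(χ). -/
def memBarP (χ : ℕ → Ω → ℝ) (P : Ω → ℝ) (S : ℕ → Ω → ℝ) : Prop :=
  (∀ ω, 0 ≤ P ω) ∧ (∑ ω, P ω) = 1 ∧ IsAdapted M S ∧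
  (∀ t ω, t ≤ M.T → M.Sb t ω ≤ S t ω ∧ S t ω ≤ M.Sa t ω) ∧
  (∀ t, t ≤ M.T → ∀ ω, 0 < P ω →
    chiStar M χ (t + 1) ω * M.Sb t ω ≤ condExp (M.F t) P (starVal M χ S (t + 1)) ω ∧
    condExp (M.F t) P (starVal M χ S (t + 1)) ω ≤ chiStar M χ (t + 1) ω * M.Sa t ω)

/-- Membership in the family P(χ): barP(χ) with P equivalent to Q. -/
def memP (χ : ℕ → Ω → ℝ) (P : Ω → ℝ) (S : ℕ → Ω → ℝ) : Prop :=
  memBarP M χ P S ∧ ∀ ω, 0 < P ω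

/-- The mixed stopping time χ^τ associated with a pure stopping time τ. -/
def pureChi (τ : Ω → ℕ) : ℕ → Ω → ℝ := fun t ω => if τ ω = t then 1 else 0

/-- Arbitrage-free: there is an equivalent probability measure and a martingale
between the bid and ask prices. -/
def ArbitrageFree : Prop :=
  ∃ (P : Ω → ℝ) (S : ℕ → Ω → ℝ),
    (∀ ω, 0 < P ω) ∧ (∑ ω, P ω) = 1 ∧ IsAdapted M S ∧
    (∀ t ω, t ≤ M.T → M.Sb t ω ≤ S t ω ∧ S t ω ≤ M.Sa t ω) ∧
    (∀ t, t < M.T → ∀ ω, 0 < P ω → condExp (M.F t) P (S (t + 1)) ω = S t ω)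

/-- Epigraph of a function ℝ → ℝ, as a subset of ℝ² (first coordinate dominates). -/
def epi (f : ℝ → ℝ) : Set (ℝ × ℝ) := {p | f p.2 ≤ p.1}

/-- The function h_{[b,a]}(y) = a y⁻ − b y⁺. -/
def hfun (b a : ℝ) (y : ℝ) : ℝ := a * max (-y) 0 - b * max y 0

/-- Seller's payoff function u_t(y) = ξ_t + (y − ζ_t)⁻ S^a_t − (y − ζ_t)⁺ S^b_t. -/
def uSell (ξ ζ : ℕ → Ω → ℝ) (t : ℕ) (ω : Ω) (y : ℝ) : ℝ :=
  ξ t ω + M.Sa t ω * max (ζ t ω - y) 0 - M.Sb t ω * max (y - ζ t ω) 0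

/-- Buyer's payoff function u_t(y) = −ξ_t + (y + ζ_t)⁻ S^a_t − (y + ζ_t)⁺ S^b_t. -/
def uBuy (ξ ζ : ℕ → Ω → ℝ) (t : ℕ) (ω : Ω) (y : ℝ) : ℝ :=
  -ξ t ω + M.Sa t ω * max (-(y + ζ t ω)) 0 - M.Sb t ω * max (y + ζ t ω) 0

/-- The seller's pricing recursion: one function per atom,
`z_T = u_T` and `epi z_{t-1} = epi u_{t-1} ∩ (epi h + ⋂_{succ} epi z_t)`. -/
def SellerRec (ξ ζ : ℕ → Ω → ℝ) (z : ℕ → Ω → ℝ → ℝ) : Prop :=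
  (∀ t ω ω', t ≤ M.T → sameAtom (M.F t) ω ω' → z t ω = z t ω') ∧
  (∀ ω, z M.T ω = uSell M ξ ζ M.T ω) ∧
  (∀ t ω, t < M.T →
    epi (z t ω) = epi (uSell M ξ ζ t ω) ∩
      (epi (hfun (M.Sb t ω) (M.Sa t ω)) +
        ⋂ ω' ∈ {ω'' | sameAtom (M.F t) ω ω''}, epi (z (t + 1) ω')))

/-- The buyer's pricing recursion: one function per atom,
`z_T = u_T` and `epi z_{t-1} = epi u_{t-1} ∪ (epi h + ⋂_{succ} epi z_t)`. -/
def BuyerRec (ξ ζ : ℕ → Ω → ℝ) (z : ℕ → Ω → ℝ → ℝ) : Prop :=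
  (∀ t ω ω', t ≤ M.T → sameAtom (M.F t) ω ω' → z t ω = z t ω') ∧
  (∀ ω, z M.T ω = uBuy M ξ ζ M.T ω) ∧
  (∀ t ω, t < M.T →
    epi (z t ω) = epi (uBuy M ξ ζ t ω) ∪
      (epi (hfun (M.Sb t ω) (M.Sa t ω)) +
        ⋂ ω' ∈ {ω'' | sameAtom (M.F t) ω ω''}, epi (z (t + 1) ω')))

section Atoms

set_option linter.unusedSectionVars false

theorem sameAtom_refl (m : MeasurableSpace Ω) (ω : Ω) : sameAtom m ω ω := fun _ _ => Iff.rfl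

theorem sameAtom.symm {m : MeasurableSpace Ω} {ω ω' : Ω} (h : sameAtom m ω ω') :
    sameAtom m ω' ω := fun A hA => (h A hA).symm

theorem sameAtom.trans {m : MeasurableSpace Ω} {ω ω' ω'' : Ω} (h : sameAtom m ω ω')
    (h' : sameAtom m ω' ω'') : sameAtom m ω ω'' := fun A hA => (h A hA).trans (h' A hA)

theorem sameAtom.mono {m m' : MeasurableSpace Ω} (hm : m ≤ m') {ω ω' : Ω}
    (h : sameAtom m' ω ω') : sameAtom m ω ω' := fun A hA => h A (hm A hA)

theorem sameAtom_bot (ω ω' : Ω) : sameAtom ⊥ ω ω' := by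
  intro A hA
  rcases MeasurableSpace.measurableSet_bot_iff.1 hA with rfl | rfl <;> simp

theorem sameAtom.eq_of_measurable {m : MeasurableSpace Ω} {ω ω' : Ω} (h : sameAtom m ω ω')
    {f : Ω → ℝ} (hf : Measurable[m] f) : f ω = f ω' :=
  ((h (f ⁻¹' {f ω}) (hf (measurableSet_singleton _))).1 rfl).symm

theorem measurableSet_atom (m : MeasurableSpace Ω) (ω : Ω) :
    MeasurableSet[m] {ω' | sameAtom m ω ω'} := by
  have h : {ω' | sameAtom m ω ω'} = ⋂ A ∈ {A : Set Ω | MeasurableSet[m] A ∧ ω ∈ A}, A := by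
    ext ω'
    simp only [Set.mem_ofPred_eq, Set.mem_iInter]
    refine ⟨fun h A hA => (h A hA.1).1 hA.2, fun h A hA => ⟨fun hω => h A ⟨hA, hω⟩, fun hω' => ?_⟩⟩
    by_contra hω
    exact h Aᶜ ⟨hA.compl, hω⟩ hω'
  rw [h]
  exact MeasurableSet.biInter (Set.toFinite _).countable fun A hA => hA.1

theorem measurable_of_sameAtom {m : MeasurableSpace Ω} {f : Ω → ℝ}
    (hf : ∀ ω ω', sameAtom m ω ω' → f ω = f ω') : Measurable[m] f := by
  intro B _
  have h : f ⁻¹' B = ⋃ ω ∈ f ⁻¹' B, {ω' | sameAtom m ω ω'} := by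
    ext ω'
    simp only [Set.mem_iUnion, Set.mem_ofPred_eq, Set.mem_preimage, exists_prop]
    exact ⟨fun h => ⟨ω', h, sameAtom_refl _ _⟩, fun ⟨ω, hω, h⟩ => hf ω ω' h ▸ hω⟩
  rw [h]
  exact MeasurableSet.biUnion (Set.toFinite _).countable fun ω _ => measurableSet_atom m ω

/-- The sum of `f` over the atom of `ω`. -/
def atomSum (m : MeasurableSpace Ω) (f : Ω → ℝ) (ω : Ω) : ℝ :=
  ∑ ω', Set.indicator {ω'' | sameAtom m ω ω''} f ω'

open Classical in
theorem atomSum_eq_sum_ite (m : MeasurableSpace Ω) (f : Ω → ℝ) (ω : Ω) :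
    atomSum m f ω = ∑ ω', if sameAtom m ω ω' then f ω' else 0 := by
  simp only [atomSum, Set.indicator_apply, Set.mem_ofPred_eq]

theorem condExp_eq_div (m : MeasurableSpace Ω) (P f : Ω → ℝ) (ω : Ω) :
    condExp m P f ω = atomSum m (fun ω' => P ω' * f ω') ω / atomSum m P ω := rfl

theorem sameAtom.atomSum_eq {m : MeasurableSpace Ω} {ω ω' : Ω} (h : sameAtom m ω ω')
    (f : Ω → ℝ) : atomSum m f ω = atomSum m f ω' := by
  have : {ω'' | sameAtom m ω ω''} = {ω'' | sameAtom m ω' ω''} := by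
    ext ω''
    exact ⟨fun h' => h.symm.trans h', fun h' => h.trans h'⟩
  simp only [atomSum, this]

theorem atomSum_mono (m : MeasurableSpace Ω) {f g : Ω → ℝ} {ω : Ω}
    (h : ∀ ω', sameAtom m ω ω' → f ω' ≤ g ω') : atomSum m f ω ≤ atomSum m g ω := by
  classical
  simp only [atomSum_eq_sum_ite]
  refine Finset.sum_le_sum fun ω' _ => ?_
  split_ifs with h'
  · exact h ω' h'
  · exact le_rfl

theorem atomSum_congr (m : MeasurableSpace Ω) {f g : Ω → ℝ} {ω : Ω}
    (h : ∀ ω', sameAtom m ω ω' → f ω' = g ω') : atomSum m f ω = atomSum m g ω :=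
  le_antisymm (atomSum_mono m fun ω' h' => (h ω' h').le)
    (atomSum_mono m fun ω' h' => (h ω' h').ge)

theorem atomSum_zero (m : MeasurableSpace Ω) (ω : Ω) : atomSum m (fun _ => 0) ω = 0 := by
  simp [atomSum]

theorem atomSum_pos (m : MeasurableSpace Ω) {f : Ω → ℝ} (hf : ∀ ω, 0 < f ω) (ω : Ω) :
    0 < atomSum m f ω := by
  refine Finset.sum_pos' (fun ω' _ => Set.indicator_nonneg (fun ω'' _ => (hf ω'').le) ω')
    ⟨ω, Finset.mem_univ _, ?_⟩
  rw [Set.indicator_of_mem (show ω ∈ {ω'' | sameAtom m ω ω''} from sameAtom_refl m ω)]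
  exact hf ω

theorem atomSum_linear (m : MeasurableSpace Ω) (a b : ℝ) (f g : Ω → ℝ) (ω : Ω) :
    atomSum m (fun ω' => a * f ω' + b * g ω') ω = a * atomSum m f ω + b * atomSum m g ω := by
  classical
  simp only [atomSum_eq_sum_ite, Finset.mul_sum, ← Finset.sum_add_distrib]
  refine Finset.sum_congr rfl fun ω' _ => ?_
  split_ifs <;> simp

theorem sum_mul_condExp_mul (m : MeasurableSpace Ω) {P : Ω → ℝ} (hP : ∀ ω, 0 < P ω)
    (f : Ω → ℝ) {φ : Ω → ℝ} (hφ : ∀ ω ω', sameAtom m ω ω' → φ ω = φ ω') :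
    ∑ ω, P ω * condExp m P f ω * φ ω = ∑ ω, P ω * f ω * φ ω := by
  classical
  have key : ∀ ω, P ω * condExp m P f ω * φ ω =
      ∑ ω', if sameAtom m ω' ω then P ω * (P ω' * f ω' * φ ω' / atomSum m P ω') else 0 := by
    intro ω
    rw [condExp_eq_div, atomSum_eq_sum_ite m (fun ω' => P ω' * f ω'), Finset.sum_div,
      Finset.mul_sum, Finset.sum_mul]
    refine Finset.sum_congr rfl fun ω' _ => ?_
    by_cases h : sameAtom m ω ω'
    · rw [if_pos h, if_pos h.symm, hφ _ _ h, h.atomSum_eq P]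
      ring
    · rw [if_neg h, if_neg fun h' => h h'.symm]
      simp
  rw [Finset.sum_congr rfl fun ω _ => key ω, Finset.sum_comm]
  refine Finset.sum_congr rfl fun ω' _ => ?_
  have h := (atomSum_pos m hP ω').ne'
  have : ∀ ω, (if sameAtom m ω' ω then P ω * (P ω' * f ω' * φ ω' / atomSum m P ω') else 0) =
      (if sameAtom m ω' ω then P ω else 0) * (P ω' * f ω' * φ ω' / atomSum m P ω') := by
    intro ω
    split_ifs <;> simp
  rw [Finset.sum_congr rfl fun ω _ => this ω, ← Finset.sum_mul, ← atomSum_eq_sum_ite]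
  field_simp

end Atoms

theorem sum_Ico_ite_sub (f : ℕ → ℝ) {t k T : ℕ} (htk : t ≤ k) (hkT : k ≤ T) :
    ∑ s ∈ Finset.Ico t T, (if s < k then f (s + 1) - f s else 0) = f k - f t := by
  rw [← Finset.sum_filter]
  have : (Finset.Ico t T).filter (· < k) = Finset.Ico t k := by
    ext s
    simp only [Finset.mem_filter, Finset.mem_Ico]
    omega
  rw [this]
  exact Finset.sum_Ico_sub f htk

section Stopping

variable {M} {τ : Ω → ℕ}

theorem IsStop.eq_iff (hτ : IsStop M τ) {t : ℕ} {ω ω' : Ω} (h : sameAtom (M.F t) ω ω') :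
    τ ω = t ↔ τ ω' = t := h _ (hτ.2 t)

theorem IsStop.eq_of_le (hτ : IsStop M τ) {t : ℕ} {ω ω' : Ω} (h : sameAtom (M.F t) ω ω')
    (ht : τ ω ≤ t) : τ ω' = τ ω := (hτ.eq_iff (h.mono (M.F_mono ht))).1 rfl

theorem IsStop.le_iff (hτ : IsStop M τ) {t : ℕ} {ω ω' : Ω} (h : sameAtom (M.F t) ω ω') :
    t ≤ τ ω ↔ t ≤ τ ω' := by
  by_contra hc
  rcases le_total (τ ω) t with h1 | h1
  · exact hc (by rw [hτ.eq_of_le h h1])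
  · rcases le_total (τ ω') t with h2 | h2
    · exact hc (by rw [hτ.eq_of_le h.symm h2])
    · exact hc (iff_of_true h1 h2)

theorem IsStop.lt_iff (hτ : IsStop M τ) {t : ℕ} {ω ω' : Ω} (h : sameAtom (M.F t) ω ω') :
    t < τ ω ↔ t < τ ω' := by
  rw [lt_iff_le_and_ne, lt_iff_le_and_ne, hτ.le_iff h, ne_comm, Ne, hτ.eq_iff h, ← Ne,
    ne_comm]

theorem isStop_zero : IsStop M (fun _ => 0) :=
  ⟨fun _ => Nat.zero_le _, fun t => by
    by_cases h : 0 = t <;> simp [h]⟩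

theorem IsStop.starVal_pureChi (hτ : IsStop M τ) (S : ℕ → Ω → ℝ) (t : ℕ) (ω : Ω) :
    starVal M (pureChi τ) S (t + 1) ω = if t < τ ω then S (τ ω) ω else 0 := by
  have := hτ.1 ω
  simp only [starVal, pureChi, ite_mul, one_mul, zero_mul, Finset.sum_ite_eq, Finset.mem_Icc,
    Nat.succ_le_iff, this, and_true]

theorem IsStop.chiStar_pureChi (hτ : IsStop M τ) (t : ℕ) (ω : Ω) :
    chiStar M (pureChi τ) (t + 1) ω = if t < τ ω then 1 else 0 := by
  have := hτ.1 ω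
  simp only [chiStar, pureChi, Finset.sum_ite_eq, Finset.mem_Icc, Nat.succ_le_iff, this,
    and_true]

theorem IsAdapted.stopped_eq {X : ℕ → Ω → ℝ} (hX : IsAdapted M X) (hτ : IsStop M τ) {ω ω' : Ω}
    (h : sameAtom (M.F (τ ω)) ω ω') : X (τ ω) ω = X (τ ω') ω' := by
  rw [hτ.eq_of_le h le_rfl]
  exact h.eq_of_measurable (hX _ (hτ.1 ω))

end Stopping

section Liquidation

variable {M}

theorem liq_nonneg_iff {t : ℕ} (ht : t ≤ M.T) {ω : Ω} {γ δ : ℝ} :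
    0 ≤ liq M t ω γ δ ↔ 0 ≤ γ + M.Sb t ω * δ ∧ 0 ≤ γ + M.Sa t ω * δ := by
  have h := M.Sb_le_Sa t ω ht
  unfold liq
  rcases le_total 0 δ with hδ | hδ
  · rw [max_eq_left hδ, max_eq_right (by linarith)]
    have := mul_le_mul_of_nonneg_right h hδ
    constructor
    · intro h'; constructor <;> linarith
    · rintro ⟨h1, -⟩; linarith
  · rw [max_eq_right hδ, max_eq_left (by linarith)]
    have := mul_le_mul_of_nonpos_right h hδ
    constructor
    · intro h'; constructor <;> linarith
    · rintro ⟨-, h1⟩; linarith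

theorem liq_add_cash (t : ℕ) (ω : Ω) (x γ δ : ℝ) :
    liq M t ω (x + γ) δ = x + liq M t ω γ δ := by
  unfold liq; ring

theorem liq_le_of_mem {t : ℕ} {ω : Ω} {s : ℝ} (h : M.Sb t ω ≤ s ∧ s ≤ M.Sa t ω) (γ δ : ℝ) :
    liq M t ω γ δ ≤ γ + s * δ := by
  unfold liq
  rcases le_total 0 δ with hδ | hδ
  · rw [max_eq_left hδ, max_eq_right (by linarith)]
    linarith [mul_le_mul_of_nonneg_right h.1 hδ]
  · rw [max_eq_right hδ, max_eq_left (by linarith)]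
    linarith [mul_le_mul_of_nonpos_right h.2 hδ]

end Liquidation

section Duality

variable {M} {τ : Ω → ℕ}

theorem SelfFinancing.zero : SelfFinancing M (fun _ _ => 0) (fun _ _ => 0) :=
  ⟨measurable_const, measurable_const, fun _ _ => ⟨measurable_const, measurable_const⟩,
    fun _ _ _ => by simp [liq]⟩

theorem SelfFinancing.add {α β α' β' : ℕ → Ω → ℝ} (h : SelfFinancing M α β)
    (h' : SelfFinancing M α' β') :
    SelfFinancing M (fun t ω => α t ω + α' t ω) (fun t ω => β t ω + β' t ω) := by
  refine ⟨h.1.add h'.1, h.2.1.add h'.2.1, fun t ht => ⟨(h.2.2.1 t ht).1.add (h'.2.2.1 t ht).1,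
    (h.2.2.1 t ht).2.add (h'.2.2.1 t ht).2⟩, fun t ht ω => ?_⟩
  have h1 := h.2.2.2 t ht ω
  have h2 := h'.2.2.2 t ht ω
  rw [liq_nonneg_iff ht.le] at h1 h2 ⊢
  constructor <;> linarith [h1.1, h1.2, h2.1, h2.2]

theorem SelfFinancing.smul {α β : ℕ → Ω → ℝ} (h : SelfFinancing M α β) {c : ℝ} (hc : 0 ≤ c) :
    SelfFinancing M (fun t ω => c * α t ω) (fun t ω => c * β t ω) := by
  refine ⟨h.1.const_mul c, h.2.1.const_mul c, fun t ht => ⟨(h.2.2.1 t ht).1.const_mul c,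
    (h.2.2.1 t ht).2.const_mul c⟩, fun t ht ω => ?_⟩
  have h1 := h.2.2.2 t ht ω
  rw [liq_nonneg_iff ht.le] at h1 ⊢
  constructor
  · linarith [mul_nonneg hc h1.1]
  · linarith [mul_nonneg hc h1.2]

/-- The claims `(u, v)`, received at time `τ`, that can be turned into a solvent position by a
self-financing strategy of zero initial cost. -/
def HedgedFromZero (M : Market Ω) (τ : Ω → ℕ) (z : (Ω → ℝ) × (Ω → ℝ)) : Prop :=
  ∃ α β, SelfFinancing M α β ∧ (∀ ω, 0 ≤ liq M 0 ω (-α 0 ω) (-β 0 ω)) ∧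
    ∀ ω, 0 ≤ liq M (τ ω) ω (α (τ ω) ω + z.1 ω) (β (τ ω) ω + z.2 ω)

theorem HedgedFromZero.of_liq_nonneg {z : (Ω → ℝ) × (Ω → ℝ)}
    (hz : ∀ ω, 0 ≤ liq M (τ ω) ω (z.1 ω) (z.2 ω)) : HedgedFromZero M τ z :=
  ⟨_, _, SelfFinancing.zero, fun ω => by simp [liq], fun ω => by simpa using hz ω⟩

theorem HedgedFromZero.add (hτ : IsStop M τ) {z z' : (Ω → ℝ) × (Ω → ℝ)}
    (h : HedgedFromZero M τ z) (h' : HedgedFromZero M τ z') : HedgedFromZero M τ (z + z') := by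
  obtain ⟨α, β, hs, h0, h1⟩ := h
  obtain ⟨α', β', hs', h0', h1'⟩ := h'
  refine ⟨_, _, hs.add hs', fun ω => ?_, fun ω => ?_⟩
  · have a := h0 ω
    have b := h0' ω
    rw [liq_nonneg_iff (Nat.zero_le _)] at a b ⊢
    constructor <;> linarith [a.1, a.2, b.1, b.2]
  · have a := h1 ω
    have b := h1' ω
    rw [liq_nonneg_iff (hτ.1 ω)] at a b ⊢
    simp only [Prod.fst_add, Prod.snd_add, Pi.add_apply]
    constructor <;> linarith [a.1, a.2, b.1, b.2]

theorem HedgedFromZero.smul (hτ : IsStop M τ) {z : (Ω → ℝ) × (Ω → ℝ)}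
    (h : HedgedFromZero M τ z) {c : ℝ} (hc : 0 ≤ c) : HedgedFromZero M τ (c • z) := by
  obtain ⟨α, β, hs, h0, h1⟩ := h
  refine ⟨_, _, hs.smul hc, fun ω => ?_, fun ω => ?_⟩
  · have a := h0 ω
    rw [liq_nonneg_iff (Nat.zero_le _)] at a ⊢
    constructor
    · linarith [mul_nonneg hc a.1]
    · linarith [mul_nonneg hc a.2]
  · have a := h1 ω
    rw [liq_nonneg_iff (hτ.1 ω)] at a ⊢
    simp only [Prod.smul_fst, Prod.smul_snd, Pi.smul_apply, smul_eq_mul]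
    constructor
    · linarith [mul_nonneg hc a.1]
    · linarith [mul_nonneg hc a.2]

/-- A solvent portfolio bought in an atom of `F t` not yet stopped strictly before `t`. -/
theorem HedgedFromZero.of_atom (hτ : IsStop M τ) {t : ℕ} {ω₀ : Ω} (ht : t ≤ τ ω₀) {c d : ℝ}
    (hcd : 0 ≤ liq M t ω₀ c d) :
    HedgedFromZero M τ (Set.indicator {ω | sameAtom (M.F t) ω₀ ω} fun _ => c,
      Set.indicator {ω | sameAtom (M.F t) ω₀ ω} fun _ => d) := by
  classical
  have htT : t ≤ M.T := ht.trans (hτ.1 ω₀)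
  have hmeas : ∀ k : ℝ, ∀ s, t ≤ s →
      Measurable[M.F s] (Set.indicator {ω | sameAtom (M.F t) ω₀ ω} fun _ => k) := by
    intro k s hs
    exact measurable_const.indicator (M.F_mono hs _ (measurableSet_atom _ _))
  have hliq : ∀ ω, sameAtom (M.F t) ω₀ ω → 0 ≤ liq M t ω c d := by
    intro ω h
    rwa [liq, ← h.eq_of_measurable (M.Sb_adapted t htT), ← h.eq_of_measurable (M.Sa_adapted t htT)]
  set A : Set Ω := {ω | sameAtom (M.F t) ω₀ ω} with hA
  refine ⟨fun s => if t < s then A.indicator fun _ => -c else fun _ => 0,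
    fun s => if t < s then A.indicator fun _ => -d else fun _ => 0,
    ⟨by simp [measurable_const], by simp [measurable_const], fun s _ => ?_, fun s _ ω => ?_⟩,
    fun ω => by simp [liq], fun ω => ?_⟩
  · by_cases hs : t < s + 1
    · simp only [if_pos hs]
      exact ⟨hmeas _ _ (by omega), hmeas _ _ (by omega)⟩
    · simp only [if_neg hs]
      exact ⟨measurable_const, measurable_const⟩
  · rcases lt_trichotomy t s with h | rfl | h
    · simp [h, h.trans (Nat.lt_succ_self s), liq]
    · by_cases hω : ω ∈ A
      · simpa [hω] using hliq ω hω
      · simp [hω, liq]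
    · simp [h.not_gt, show ¬ t < s + 1 by omega, liq]
  · by_cases hω : ω ∈ A
    · rcases ((hτ.le_iff hω).1 ht).lt_or_eq with h | h
      · simp [h, hω, liq]
      · simpa [← h, hω] using hliq ω hω
    · by_cases h : t < τ ω <;> simp [hω, h, liq]

/-- Pairs `(m, n)` dual to the cone of `HedgedFromZero`: `m` is a probability, and `n` (the
stock price at `τ` times `m`) has atomwise averages between the bid and ask prices up to `τ`. -/
structure DualFeasible (M : Market Ω) (τ : Ω → ℕ) (m n : Ω → ℝ) : Prop where
  nonneg : ∀ ω, 0 ≤ m ω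
  sum_eq_one : ∑ ω, m ω = 1
  bid_le : ∀ t ω, t ≤ τ ω → M.Sb t ω * atomSum (M.F t) m ω ≤ atomSum (M.F t) n ω
  le_ask : ∀ t ω, t ≤ τ ω → atomSum (M.F t) n ω ≤ M.Sa t ω * atomSum (M.F t) m ω

theorem DualFeasible.convex {m n m' n' : Ω → ℝ} (h : DualFeasible M τ m n)
    (h' : DualFeasible M τ m' n') {a b : ℝ} (ha : 0 ≤ a) (hb : 0 ≤ b) (hab : a + b = 1) :
    DualFeasible M τ (fun ω => a * m ω + b * m' ω) (fun ω => a * n ω + b * n' ω) where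
  nonneg ω := add_nonneg (mul_nonneg ha (h.nonneg ω)) (mul_nonneg hb (h'.nonneg ω))
  sum_eq_one := by
    rw [Finset.sum_add_distrib, ← Finset.mul_sum, ← Finset.mul_sum, h.sum_eq_one, h'.sum_eq_one]
    linarith
  bid_le t ω ht := by
    rw [atomSum_linear, atomSum_linear]
    linarith [mul_le_mul_of_nonneg_left (h.bid_le t ω ht) ha,
      mul_le_mul_of_nonneg_left (h'.bid_le t ω ht) hb]
  le_ask t ω ht := by
    rw [atomSum_linear, atomSum_linear]
    linarith [mul_le_mul_of_nonneg_left (h.le_ask t ω ht) ha,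
      mul_le_mul_of_nonneg_left (h'.le_ask t ω ht) hb]

theorem exists_dualFeasible_pos (hNA : ArbitrageFree M) (hτ : IsStop M τ) :
    ∃ m n, DualFeasible M τ m n ∧ ∀ ω, 0 < m ω := by
  classical
  obtain ⟨P, S, hP, hP1, hS, hSb, hmart⟩ := hNA
  have key : ∀ t ω, t ≤ τ ω →
      atomSum (M.F t) (fun ω' => P ω' * S (τ ω') ω') ω = S t ω * atomSum (M.F t) P ω := by
    intro t ω ht
    have hterm : ∀ s ∈ Finset.Ico t M.T, ∑ ω', P ω' *
        (if sameAtom (M.F t) ω ω' ∧ s < τ ω' then S (s + 1) ω' - S s ω' else 0) = 0 := by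
      intro s hs
      rw [Finset.mem_Ico] at hs
      have h := sum_mul_condExp_mul (M.F s) hP (S (s + 1))
        (φ := fun ω' => if sameAtom (M.F t) ω ω' ∧ s < τ ω' then 1 else 0) (by
          intro ω₁ ω₂ h12
          have h1 : sameAtom (M.F t) ω ω₁ ↔ sameAtom (M.F t) ω ω₂ :=
            ⟨fun h => h.trans (h12.mono (M.F_mono hs.1)),
              fun h => h.trans (h12.mono (M.F_mono hs.1)).symm⟩
          simp only [h1, hτ.lt_iff h12])
      rw [← sub_eq_zero, ← Finset.sum_sub_distrib] at h
      rw [← neg_eq_zero, ← Finset.sum_neg_distrib]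
      refine (Finset.sum_congr rfl fun ω' _ => ?_).trans h
      rw [hmart s hs.2 ω' (hP ω')]
      split_ifs <;> ring
    have hsum := Finset.sum_eq_zero hterm
    rw [Finset.sum_comm] at hsum
    rw [← sub_eq_zero, atomSum_eq_sum_ite, atomSum_eq_sum_ite, Finset.mul_sum,
      ← Finset.sum_sub_distrib]
    refine (Finset.sum_congr rfl fun ω' _ => ?_).trans hsum
    by_cases h : sameAtom (M.F t) ω ω'
    · simp only [h, true_and, if_true, ← Finset.mul_sum]
      rw [sum_Ico_ite_sub (fun s => S s ω') ((hτ.le_iff h).1 ht) (hτ.1 ω'),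
        h.eq_of_measurable (hS t (ht.trans (hτ.1 ω)))]
      ring
    · simp [h]
  refine ⟨P, fun ω => P ω * S (τ ω) ω, ⟨fun ω => (hP ω).le, hP1, fun t ω ht => ?_,
    fun t ω ht => ?_⟩, hP⟩
  · rw [key t ω ht]
    exact mul_le_mul_of_nonneg_right (hSb t ω (ht.trans (hτ.1 ω))).1 (atomSum_pos _ hP ω).le
  · rw [key t ω ht]
    exact mul_le_mul_of_nonneg_right (hSb t ω (ht.trans (hτ.1 ω))).2 (atomSum_pos _ hP ω).le

/-- Averaging the density `n / m` over atoms turns a positive dual-feasible pair into a pricing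
pair. -/
theorem DualFeasible.exists_memP {ξ ζ : ℕ → Ω → ℝ} (hζ : IsAdapted M ζ)
    (hτ : IsStop M τ) {m n : Ω → ℝ} (h : DualFeasible M τ m n) (hm : ∀ ω, 0 < m ω) :
    ∃ P S, memP M (pureChi τ) P S ∧
      expect P (fun ω => ξ (τ ω) ω + S (τ ω) ω * ζ (τ ω) ω) =
        ∑ ω, (m ω * ξ (τ ω) ω + n ω * ζ (τ ω) ω) := by
  classical
  set S : ℕ → Ω → ℝ := fun t ω =>
    if t ≤ τ ω then atomSum (M.F t) n ω / atomSum (M.F t) m ω else M.Sb t ω with hSdef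
  have htower : ∀ φ : Ω → ℝ, (∀ ω ω', sameAtom (M.F (τ ω)) ω ω' → φ ω = φ ω') →
      ∑ ω, m ω * S (τ ω) ω * φ ω = ∑ ω, n ω * φ ω := by
    intro φ hφ
    have hsplit : ∀ f : ℕ → Ω → ℝ, ∑ ω, f (τ ω) ω * φ ω =
        ∑ t ∈ Finset.range (M.T + 1), ∑ ω, f t ω * (if τ ω = t then φ ω else 0) := by
      intro f
      rw [Finset.sum_comm]
      refine Finset.sum_congr rfl fun ω _ => ?_
      simp [Finset.sum_ite_eq, hτ.1 ω]
    have hl : ∀ ω, S (τ ω) ω = condExp (M.F (τ ω)) m (fun ω => n ω / m ω) ω := by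
      intro ω
      rw [condExp_eq_div]
      simp only [hSdef, le_refl, if_true]
      congr 1
      exact atomSum_congr _ fun ω' _ => (mul_div_cancel₀ _ (hm ω').ne').symm
    simp only [hl]
    rw [hsplit (fun t ω => m ω * condExp (M.F t) m (fun ω => n ω / m ω) ω),
      hsplit (fun _ ω => n ω)]
    refine Finset.sum_congr rfl fun t _ => ?_
    rw [sum_mul_condExp_mul (M.F t) hm]
    · exact Finset.sum_congr rfl fun ω _ => by rw [mul_div_cancel₀ _ (hm ω).ne']
    · intro ω ω' h'
      by_cases ht : τ ω = t
      · rw [if_pos ht, if_pos ((hτ.eq_iff h').1 ht)]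
        exact hφ _ _ (ht ▸ h')
      · rw [if_neg ht, if_neg fun h'' => ht ((hτ.eq_iff h').2 h'')]
  have hbd : ∀ t ω, t ≤ τ ω → M.Sb t ω ≤ atomSum (M.F t) n ω / atomSum (M.F t) m ω ∧
      atomSum (M.F t) n ω / atomSum (M.F t) m ω ≤ M.Sa t ω := by
    intro t ω ht
    rw [le_div_iff₀ (atomSum_pos _ hm ω), div_le_iff₀ (atomSum_pos _ hm ω)]
    exact ⟨h.bid_le t ω ht, h.le_ask t ω ht⟩
  refine ⟨m, S, ⟨⟨h.nonneg, h.sum_eq_one, fun t ht => ?_, fun t ω ht => ?_, fun t ht ω _ => ?_⟩,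
    hm⟩, ?_⟩
  · refine measurable_of_sameAtom fun ω ω' h' => ?_
    simp only [hSdef, hτ.le_iff h', h'.atomSum_eq, h'.eq_of_measurable (M.Sb_adapted t ht)]
  · by_cases h' : t ≤ τ ω
    · simpa only [hSdef, if_pos h'] using hbd t ω h'
    · simpa only [hSdef, if_neg h'] using ⟨le_rfl, M.Sb_le_Sa t ω ht⟩
  · rw [hτ.chiStar_pureChi, condExp_eq_div]
    by_cases hlt : t < τ ω
    · have heq : atomSum (M.F t) (fun ω' => m ω' * starVal M (pureChi τ) S (t + 1) ω') ω =
          atomSum (M.F t) n ω := by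
        have := htower (fun ω' => if sameAtom (M.F t) ω ω' then 1 else 0) (by
          intro ω₁ ω₂ h12
          by_cases ht1 : t ≤ τ ω₁
          · have h12' := h12.mono (M.F_mono ht1)
            have h1 : sameAtom (M.F t) ω ω₁ ↔ sameAtom (M.F t) ω ω₂ :=
              ⟨fun h => h.trans h12', fun h => h.trans h12'.symm⟩
            simp only [h1]
          · have ht2 : ¬ t ≤ τ ω₂ := by rwa [hτ.eq_of_le h12 le_rfl]
            rw [if_neg fun h' => ht1 ((hτ.le_iff h').1 hlt.le),
              if_neg fun h' => ht2 ((hτ.le_iff h').1 hlt.le)])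
        rw [atomSum_eq_sum_ite, atomSum_eq_sum_ite]
        simp only [mul_ite, mul_one, mul_zero] at this
        rw [← this]
        refine Finset.sum_congr rfl fun ω' _ => ?_
        by_cases h' : sameAtom (M.F t) ω ω'
        · rw [if_pos h', if_pos h', hτ.starVal_pureChi, if_pos ((hτ.lt_iff h').1 hlt)]
        · rw [if_neg h', if_neg h']
      rw [heq, if_pos hlt, one_mul, one_mul]
      exact hbd t ω hlt.le
    · have heq : atomSum (M.F t) (fun ω' => m ω' * starVal M (pureChi τ) S (t + 1) ω') ω = 0 := by
        rw [← atomSum_zero (M.F t) ω]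
        refine atomSum_congr _ fun ω' h' => ?_
        rw [hτ.starVal_pureChi, if_neg fun h'' => hlt ((hτ.lt_iff h').2 h''), mul_zero]
      rw [heq, if_neg hlt]
      simp
  · have := htower (fun ω => ζ (τ ω) ω) fun ω ω' h' => hζ.stopped_eq hτ h'
    simp only [expect, mul_add, Finset.sum_add_distrib, ← mul_assoc, this]

/-- The initial endowment raised by a strategy hedging at `τ` is at most every expected payoff. -/
theorem memP.liq_le_expect {ξ ζ α β S : ℕ → Ω → ℝ} {P : Ω → ℝ} (hτ : IsStop M τ)
    (hPS : memP M (pureChi τ) P S) (hs : SelfFinancing M α β)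
    (hh : ∀ ω, 0 ≤ liq M (τ ω) ω (α (τ ω) ω + ξ (τ ω) ω) (β (τ ω) ω + ζ (τ ω) ω)) {x : ℝ}
    (hx : ∀ ω, x = liq M 0 ω (-α 0 ω) (-β 0 ω)) :
    x ≤ expect P (fun ω => ξ (τ ω) ω + S (τ ω) ω * ζ (τ ω) ω) := by
  classical
  obtain ⟨⟨-, hP1, hS, hSb, hcond⟩, hP⟩ := hPS
  simp only [hτ.chiStar_pureChi] at hcond
  have hstep : ∀ t ∈ Finset.Ico 0 M.T, ∑ ω, P ω * (if t < τ ω then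
      (α (t + 1) ω + S (τ ω) ω * β (t + 1) ω) - (α t ω + S (τ ω) ω * β t ω) else 0) ≤ 0 := by
    intro t ht
    have htT := (Finset.mem_Ico.1 ht).2
    have hmeas : Measurable[M.F t] (α t) ∧ Measurable[M.F t] (β t) := by
      rcases t with _ | t
      · exact ⟨hs.1, hs.2.1⟩
      · have := hs.2.2.1 t (by omega)
        exact ⟨this.1.mono (M.F_mono t.le_succ) le_rfl, this.2.mono (M.F_mono t.le_succ) le_rfl⟩
    have hadj := sum_mul_condExp_mul (M.F t) hP (starVal M (pureChi τ) S (t + 1))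
      (φ := fun ω => β (t + 1) ω - β t ω) fun ω ω' h => by
        rw [h.eq_of_measurable (hs.2.2.1 t htT).2, h.eq_of_measurable hmeas.2]
    have hsplit : ∀ ω, P ω * (if t < τ ω then
        (α (t + 1) ω + S (τ ω) ω * β (t + 1) ω) - (α t ω + S (τ ω) ω * β t ω) else 0) =
        P ω * (if t < τ ω then α (t + 1) ω - α t ω else 0) +
          P ω * starVal M (pureChi τ) S (t + 1) ω * (β (t + 1) ω - β t ω) := by
      intro ω
      rw [hτ.starVal_pureChi]
      split_ifs <;> ring
    rw [Finset.sum_congr rfl fun ω _ => hsplit ω, Finset.sum_add_distrib, ← hadj,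
      ← Finset.sum_add_distrib]
    refine Finset.sum_nonpos fun ω _ => ?_
    rw [mul_assoc, ← mul_add]
    refine mul_nonpos_of_nonneg_of_nonpos (hP ω).le ?_
    have hc := hcond t htT.le ω (hP ω)
    split_ifs at hc ⊢ with hlt
    · rw [one_mul, one_mul] at hc
      have := (hs.2.2.2 t htT ω).trans (liq_le_of_mem hc _ _)
      linarith
    · rw [zero_mul] at hc
      rw [zero_mul] at hc
      rw [le_antisymm hc.2 hc.1]
      simp
  have htel := Finset.sum_nonpos hstep
  rw [Finset.sum_comm] at htel
  simp only [← Finset.mul_sum] at htel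
  have htel' : ∑ ω, P ω * (α (τ ω) ω + S (τ ω) ω * β (τ ω) ω) ≤
      ∑ ω, P ω * (α 0 ω + S (τ ω) ω * β 0 ω) := by
    rw [← sub_nonpos, ← Finset.sum_sub_distrib]
    refine le_trans (le_of_eq ?_) htel
    refine Finset.sum_congr rfl fun ω _ => ?_
    rw [sum_Ico_ite_sub (fun t => α t ω + S (τ ω) ω * β t ω) (Nat.zero_le _) (hτ.1 ω)]
    ring
  have hinit : ∑ ω, P ω * (α 0 ω + S (τ ω) ω * β 0 ω) ≤ -x := by
    have hadj := sum_mul_condExp_mul (M.F 0) hP (starVal M (pureChi τ) S (0 + 1))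
      (φ := β 0) fun ω ω' h => h.eq_of_measurable hs.2.1
    have hsplit : ∀ ω, P ω * (α 0 ω + S (τ ω) ω * β 0 ω) =
        P ω * (α 0 ω + (if 0 < τ ω then 0 else S 0 ω) * β 0 ω) +
          P ω * starVal M (pureChi τ) S (0 + 1) ω * β 0 ω := by
      intro ω
      rw [hτ.starVal_pureChi]
      split_ifs with h
      · ring
      · rw [Nat.eq_zero_of_not_pos h]
        ring
    rw [Finset.sum_congr rfl fun ω _ => hsplit ω, Finset.sum_add_distrib, ← hadj,
      ← Finset.sum_add_distrib]
    have : -x = ∑ ω, P ω * -x := by rw [← Finset.sum_mul, hP1, one_mul]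
    rw [this]
    refine Finset.sum_le_sum fun ω _ => ?_
    rw [mul_assoc, ← mul_add]
    refine mul_le_mul_of_nonneg_left ?_ (hP ω).le
    have hc := hcond 0 (Nat.zero_le _) ω (hP ω)
    rw [hx ω]
    split_ifs at hc ⊢ with hlt
    · rw [one_mul, one_mul] at hc
      linarith [liq_le_of_mem hc (-α 0 ω) (-β 0 ω)]
    · rw [zero_mul, zero_mul] at hc
      rw [le_antisymm hc.2 hc.1]
      linarith [liq_le_of_mem (hSb 0 ω (Nat.zero_le _)) (-α 0 ω) (-β 0 ω)]
  have hterm : 0 ≤ ∑ ω, P ω * (α (τ ω) ω + S (τ ω) ω * β (τ ω) ω) +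
      ∑ ω, P ω * (ξ (τ ω) ω + S (τ ω) ω * ζ (τ ω) ω) := by
    rw [← Finset.sum_add_distrib]
    refine Finset.sum_nonneg fun ω _ => ?_
    rw [← mul_add]
    refine mul_nonneg (hP ω).le ?_
    linarith [(hh ω).trans (liq_le_of_mem (hSb (τ ω) ω (hτ.1 ω)) _ _)]
  unfold expect
  linarith

theorem exists_hedge_of_hedgedFromZero {ξ ζ : ℕ → Ω → ℝ} {x : ℝ}
    (h : HedgedFromZero M τ (fun ω => ξ (τ ω) ω - x, fun ω => ζ (τ ω) ω)) :
    ∃ α β, SelfFinancing M α β ∧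
      (∀ ω, 0 ≤ liq M (τ ω) ω (α (τ ω) ω + ξ (τ ω) ω) (β (τ ω) ω + ζ (τ ω) ω)) ∧
      ∃ y, x ≤ y ∧ ∀ ω, y = liq M 0 ω (-α 0 ω) (-β 0 ω) := by
  obtain ⟨α, β, hs, h0, h1⟩ := h
  refine ⟨fun t ω => α t ω - x, β, ⟨hs.1.sub_const x, hs.2.1, fun t ht =>
    ⟨(hs.2.2.1 t ht).1.sub_const x, (hs.2.2.1 t ht).2⟩, fun t ht ω => ?_⟩, fun ω => ?_, ?_⟩
  · simpa using hs.2.2.2 t ht ω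
  · convert h1 ω using 2
    ring
  · have hΩ : Nonempty Ω := by
      by_contra hc
      rw [not_nonempty_iff] at hc
      simpa using M.Q_sum
    obtain ⟨ω₀⟩ := hΩ
    refine ⟨liq M 0 ω₀ (-(α 0 ω₀ - x)) (-β 0 ω₀), ?_, fun ω => ?_⟩
    · have := h0 ω₀
      have h2 := liq_add_cash (M := M) 0 ω₀ x (-α 0 ω₀) (-β 0 ω₀)
      rw [show -(α 0 ω₀ - x) = x + -α 0 ω₀ by ring, h2]
      linarith
    · have ha : sameAtom (M.F 0) ω₀ ω := by
        rw [M.F_zero]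
        exact sameAtom_bot _ _
      simp only [liq, ha.eq_of_measurable hs.1, ha.eq_of_measurable hs.2.1,
        ha.eq_of_measurable (M.Sb_adapted 0 (Nat.zero_le _)),
        ha.eq_of_measurable (M.Sa_adapted 0 (Nat.zero_le _))]

theorem exists_hedgedFromZero_cash_add (z : (Ω → ℝ) × (Ω → ℝ)) :
    ∃ c : ℝ, HedgedFromZero M τ (fun ω => z.1 ω + c, z.2) := by
  refine ⟨∑ ω, |liq M (τ ω) ω (z.1 ω) (z.2 ω)|, .of_liq_nonneg fun ω => ?_⟩
  have h1 := Finset.single_le_sum (f := fun ω => |liq M (τ ω) ω (z.1 ω) (z.2 ω)|)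
    (fun ω _ => abs_nonneg _) (Finset.mem_univ ω)
  have h2 := neg_abs_le (liq M (τ ω) ω (z.1 ω) (z.2 ω))
  simp only at h1 ⊢
  rw [add_comm, liq_add_cash]
  linarith

/-- The claims that can be hedged from zero after adding a nonnegative multiple of `y`. -/
def hedgeCone (hτ : IsStop M τ) (y : (Ω → ℝ) × (Ω → ℝ)) :
    PointedCone ℝ ((Ω → ℝ) × (Ω → ℝ)) where
  carrier := {z | ∃ k : ℝ, 0 ≤ k ∧ HedgedFromZero M τ (z + k • y)}
  add_mem' := by
    rintro z z' ⟨k, hk, h⟩ ⟨k', hk', h'⟩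
    refine ⟨k + k', add_nonneg hk hk', ?_⟩
    convert h.add hτ h' using 1
    module
  zero_mem' := ⟨0, le_rfl, .of_liq_nonneg fun ω => by simp [liq]⟩
  smul_mem' := by
    rintro c z ⟨k, hk, h⟩
    refine ⟨c * k, mul_nonneg c.2 hk, ?_⟩
    convert h.smul hτ c.2 using 1
    rw [smul_add, smul_smul]
    rfl

theorem exists_dualFeasible_of_not_hedged (hτ : IsStop M τ) {y : (Ω → ℝ) × (Ω → ℝ)}
    (hy : ¬ HedgedFromZero M τ y) :
    ∃ m n, DualFeasible M τ m n ∧ ∑ ω, (m ω * y.1 ω + n ω * y.2 ω) ≤ 0 := by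
  classical
  set e : (Ω → ℝ) × (Ω → ℝ) := (fun _ => 1, fun _ => 0) with he
  have hpos : ∀ c : ℝ, 0 ≤ c → HedgedFromZero M τ (c • e) := fun c hc =>
    .of_liq_nonneg fun ω => by simpa [he, liq] using hc
  have hunit : ∀ z, ∃ c : ℝ, HedgedFromZero M τ (c • e + z) := by
    intro z
    obtain ⟨c, hc⟩ := exists_hedgedFromZero_cash_add (M := M) (τ := τ) z
    refine ⟨c, ?_⟩
    convert hc using 1
    ext ω <;> simp [he, add_comm]
  have hneg : ∀ c : ℝ, HedgedFromZero M τ (c • e) → 0 ≤ c := by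
    intro c hc
    by_contra! hlt
    obtain ⟨d, hd⟩ := hunit y
    refine hy ?_
    have h1 := hd.add hτ (hc.smul hτ (c := |d| / -c)
      (div_nonneg (abs_nonneg d) (by linarith)))
    have h2 := h1.add hτ (hpos (|d| - d) (by linarith [le_abs_self d]))
    convert h2 using 1
    rw [smul_smul, show |d| / -c * c = -|d| by rw [div_neg, neg_mul, div_mul_cancel₀ _ hlt.ne]]
    module
  have he0 : e ≠ 0 := by
    intro h0
    have := hneg (-1) (by rw [h0, smul_zero]; simpa [h0] using hpos 0 le_rfl)
    linarith
  obtain ⟨g, hge, hg⟩ := riesz_extension (hedgeCone hτ y)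
    (LinearPMap.mkSpanSingleton e (1 : ℝ) he0) (by
      rintro ⟨x, hx⟩ ⟨k, hk, h⟩
      obtain ⟨c, rfl⟩ := Submodule.mem_span_singleton.1 hx
      rw [LinearPMap.mkSpanSingleton'_apply]
      simp only [RingHom.id_apply, smul_eq_mul, mul_one]
      by_contra! hlt
      rcases hk.eq_or_lt with rfl | hk
      · refine hlt.not_ge (hneg c ?_)
        simpa using h
      · have h1 := (h.add hτ (hpos (-c) (by linarith))).smul hτ (inv_nonneg.2 hk.le)
        refine hy ?_
        convert h1 using 1
        simp only
        rw [show c • e + k • y + -c • e = k • y by module, smul_smul, inv_mul_cancel₀ hk.ne',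
          one_smul]) (by
      intro z
      obtain ⟨c, hc⟩ := hunit z
      refine ⟨⟨c • e, Submodule.mem_span_singleton.2 ⟨c, rfl⟩⟩, 0, le_rfl, ?_⟩
      simpa using hc)
  have hg0 : ∀ z, HedgedFromZero M τ z → 0 ≤ g z := fun z hz => hg z ⟨0, le_rfl, by simpa using hz⟩
  have hgy : g y ≤ 0 := by
    have := hg (-y) ⟨1, zero_le_one, by simpa using hpos 0 le_rfl⟩
    rw [map_neg] at this
    linarith
  have hge1 : g e = 1 := by
    rw [← LinearPMap.mkSpanSingleton_apply ℝ ℝ (σ := RingHom.id ℝ) he0 (1 : ℝ), ← hge]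
  set m : Ω → ℝ := fun ω => g (fun ω' => if ω = ω' then 1 else 0, 0) with hm
  set n : Ω → ℝ := fun ω => g (0, fun ω' => if ω = ω' then 1 else 0) with hn
  have hrep : ∀ z, g z = ∑ ω, (m ω * z.1 ω + n ω * z.2 ω) := by
    intro z
    have h1 := LinearMap.pi_apply_eq_sum_univ (g ∘ₗ LinearMap.inl ℝ (Ω → ℝ) (Ω → ℝ)) z.1
    have h2 := LinearMap.pi_apply_eq_sum_univ (g ∘ₗ LinearMap.inr ℝ (Ω → ℝ) (Ω → ℝ)) z.2
    simp only [LinearMap.comp_apply, LinearMap.inl_apply, LinearMap.inr_apply, smul_eq_mul]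
      at h1 h2
    rw [Finset.sum_add_distrib, show z = (z.1, 0) + (0, z.2) by simp, map_add, h1, h2]
    simp [hm, hn, mul_comm]
  have hatom : ∀ t ω, t ≤ τ ω → ∀ c d, 0 ≤ liq M t ω c d →
      0 ≤ c * atomSum (M.F t) m ω + d * atomSum (M.F t) n ω := by
    intro t ω ht c d hcd
    have h := hg0 _ (HedgedFromZero.of_atom hτ ht hcd)
    rw [hrep] at h
    rw [atomSum_eq_sum_ite, atomSum_eq_sum_ite, Finset.mul_sum, Finset.mul_sum,
      ← Finset.sum_add_distrib]
    refine h.trans_eq (Finset.sum_congr rfl fun ω' _ => ?_)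
    simp only [Set.indicator_apply, Set.mem_ofPred_eq]
    split_ifs <;> ring
  refine ⟨m, n, ⟨fun ω => hg0 _ (.of_liq_nonneg fun ω' => ?_), ?_, fun t ω ht => ?_,
    fun t ω ht => ?_⟩, (hrep y).symm.trans_le hgy⟩
  · by_cases h : ω = ω' <;> simp [h, liq]
  · rw [← hge1, hrep e]
    simp [he]
  · have := hatom t ω ht (-M.Sb t ω) 1 (by simp [liq])
    linarith
  · have := hatom t ω ht (M.Sa t ω) (-1) (by simp [liq])
    linarith

theorem bddBelow_and_nonempty_expect {ξ ζ : ℕ → Ω → ℝ} (hpay : AdaptedPair M ξ ζ)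
    (hNA : ArbitrageFree M) (hτ : IsStop M τ) :
    BddBelow {x | ∃ P S, memP M (pureChi τ) P S ∧
      x = expect P (fun ω => ξ (τ ω) ω + S (τ ω) ω * ζ (τ ω) ω)} ∧
    {x | ∃ P S, memP M (pureChi τ) P S ∧
      x = expect P (fun ω => ξ (τ ω) ω + S (τ ω) ω * ζ (τ ω) ω)}.Nonempty := by
  constructor
  · obtain ⟨c, hc⟩ := exists_hedgedFromZero_cash_add (M := M) (τ := τ)
      (fun ω => ξ (τ ω) ω, fun ω => ζ (τ ω) ω)
    obtain ⟨α, β, hs, hh, y, -, hy⟩ := exists_hedge_of_hedgedFromZero (ξ := ξ) (ζ := ζ) (x := -c)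
      (by simpa using hc)
    refine ⟨y, ?_⟩
    rintro _ ⟨P, S, hPS, rfl⟩
    exact hPS.liq_le_expect hτ hs hh hy
  · obtain ⟨m, n, h, hm⟩ := exists_dualFeasible_pos hNA hτ
    obtain ⟨P, S, hPS, -⟩ := h.exists_memP (ξ := ξ) hpay.2 hτ hm
    exact ⟨_, P, S, hPS, rfl⟩

/-- A claim price strictly below every expected payoff can be raised from a hedge at `τ`. -/
theorem hedgedFromZero_of_lt_sInf {ξ ζ : ℕ → Ω → ℝ} (hpay : AdaptedPair M ξ ζ)
    (hNA : ArbitrageFree M) (hτ : IsStop M τ) {x : ℝ}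
    (hx : x < sInf {x | ∃ P S, memP M (pureChi τ) P S ∧
      x = expect P (fun ω => ξ (τ ω) ω + S (τ ω) ω * ζ (τ ω) ω)}) :
    HedgedFromZero M τ (fun ω => ξ (τ ω) ω - x, fun ω => ζ (τ ω) ω) := by
  by_contra hc
  obtain ⟨m, n, h, hmn⟩ := exists_dualFeasible_of_not_hedged hτ hc
  obtain ⟨m₀, n₀, h₀, hm₀⟩ := exists_dualFeasible_pos hNA hτ
  set V := sInf {x | ∃ P S, memP M (pureChi τ) P S ∧
      x = expect P (fun ω => ξ (τ ω) ω + S (τ ω) ω * ζ (τ ω) ω)}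
  set v := ∑ ω, (m ω * ξ (τ ω) ω + n ω * ζ (τ ω) ω) with hv
  set v₀ := ∑ ω, (m₀ ω * ξ (τ ω) ω + n₀ ω * ζ (τ ω) ω) with hv₀
  have hvx : v ≤ x := by
    have : v - x = ∑ ω, (m ω * (ξ (τ ω) ω - x) + n ω * ζ (τ ω) ω) := by
      rw [hv, ← one_mul x, ← h.sum_eq_one, Finset.sum_mul, ← Finset.sum_sub_distrib]
      refine Finset.sum_congr rfl fun ω _ => ?_
      rw [← Finset.sum_mul, h.sum_eq_one]
      ring
    linarith
  have hle : ∀ ε : ℝ, 0 < ε → ε ≤ 1 → V ≤ (1 - ε) * v + ε * v₀ := by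
    intro ε hε hε1
    obtain ⟨P, S, hPS, hval⟩ := (h.convex h₀ (sub_nonneg.2 hε1) hε.le (by ring)).exists_memP
      (ξ := ξ) hpay.2 hτ fun ω => add_pos_of_nonneg_of_pos
        (mul_nonneg (sub_nonneg.2 hε1) (h.nonneg ω)) (mul_pos hε (hm₀ ω))
    refine (csInf_le (bddBelow_and_nonempty_expect hpay hNA hτ).1 ⟨P, S, hPS, rfl⟩).trans_eq ?_
    rw [hval, hv, hv₀, Finset.mul_sum, Finset.mul_sum, ← Finset.sum_add_distrib]
    exact Finset.sum_congr rfl fun ω _ => by ring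
  have hd : 0 < V - v := by linarith
  have h1 := hle 1 one_pos le_rfl
  have hv₀v : 0 < v₀ - v := by linarith
  have h2 := hle ((V - v) / (2 * (v₀ - v))) (by positivity)
    (by rw [div_le_one (by positivity)]; linarith)
  have h3 : (V - v) / (2 * (v₀ - v)) * (v₀ - v) = (V - v) / 2 := by field_simp
  linarith

end Duality

/-- Theorem: π^b(ξ,ζ) = max over pure stopping times τ of the infimum over
(P,S) ∈ P(τ) of E_P(ξ_τ + S_τ ζ_τ); the maximum over τ is attained. -/
theorem buyer_price_max_inf (ξ ζ : ℕ → Ω → ℝ)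
    (hpay : AdaptedPair M ξ ζ) (hNA : ArbitrageFree M) :
    (∀ τ, IsStop M τ →
        sInf {x | ∃ P S, memP M (pureChi τ) P S ∧
          x = expect P (fun ω => ξ (τ ω) ω + S (τ ω) ω * ζ (τ ω) ω)} ≤
          bidPrice M ξ ζ) ∧
    ∃ τ, IsStop M τ ∧
      bidPrice M ξ ζ = sInf {x | ∃ P S, memP M (pureChi τ) P S ∧
        x = expect P (fun ω => ξ (τ ω) ω + S (τ ω) ω * ζ (τ ω) ω)} := by
  classical
  set V : (Ω → ℕ) → ℝ := fun τ => sInf {x | ∃ P S, memP M (pureChi τ) P S ∧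
    x = expect P (fun ω => ξ (τ ω) ω + S (τ ω) ω * ζ (τ ω) ω)} with hV
  have hfin : {τ : Ω → ℕ | IsStop M τ}.Finite :=
    (Set.Finite.pi' fun _ : Ω => Set.finite_Iic M.T).subset fun τ hτ ω => hτ.1 ω
  obtain ⟨σ, hσ, hmax⟩ := hfin.exists_maximalFor V _ ⟨_, isStop_zero⟩
  replace hmax : ∀ τ, IsStop M τ → V τ ≤ V σ := fun τ hτ =>
    (le_total (V τ) (V σ)).elim id fun h => hmax hτ h
  have hbid : ∀ x ∈ {x | ∃ α β, BuyerHedge M ξ ζ α β ∧ ∀ ω, x = liq M 0 ω (-α 0 ω) (-β 0 ω)},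
      x ≤ V σ := by
    rintro x ⟨α, β, ⟨hs, τ, hτ, hh⟩, hx⟩
    refine le_trans (le_csInf (bddBelow_and_nonempty_expect hpay hNA hτ).2 ?_) (hmax τ hτ)
    rintro _ ⟨P, S, hPS, rfl⟩
    exact hPS.liq_le_expect hτ hs hh hx
  have hge : ∀ τ, IsStop M τ → V τ ≤ bidPrice M ξ ζ := by
    intro τ hτ
    refine le_of_forall_lt fun x hx => ?_
    obtain ⟨x', hxx', hx'⟩ := exists_between hx
    obtain ⟨α, β, hs, hh, y, hxy, hy⟩ :=
      exists_hedge_of_hedgedFromZero (hedgedFromZero_of_lt_sInf hpay hNA hτ hx')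
    exact (hxx'.trans_le hxy).trans_le (le_csSup ⟨_, hbid⟩ ⟨α, β, ⟨hs, τ, hτ, hh⟩, hy⟩)
  refine ⟨hge, σ, hσ, le_antisymm (csSup_le ?_ hbid) (hge σ hσ)⟩
  obtain ⟨α, β, hs, hh, y, -, hy⟩ :=
    exists_hedge_of_hedgedFromZero (hedgedFromZero_of_lt_sInf hpay hNA hσ (sub_one_lt (V σ)))
  exact ⟨y, α, β, ⟨hs, σ, hσ, hh⟩, hy⟩

end RZ
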